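/- Let Γ be a strongly regular graph with parameters (28, 9, 0, 4), let x and y be adjacent vertices, and let Z be the set of the vertices other than x and y that are adjacent to neither x nor y. Then Z has exactly 10 elements and every vertex z ∈ Z has exactly one neighbor in Z; in particular, the induced subgraph on Z is a disjoint union of five edges. -/

import Mathlib

open SimpleGraph

/-- Disjoint neighborhoods of `x` and `y` split a set into the neighbors of `x`, the neighbors of
`y`, and the rest. -/
lemma ncard_inter_neighborSet_add_ncard_sdiff {V : Type*} [Finite V] (G : SimpleGraph V)
    {x y : V} (hdisj : Disjoint (G.neighborSet x) (G.neighborSet y)) (s : Set V) :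
    (s ∩ G.neighborSet x).ncard + (s ∩ G.neighborSet y).ncard +
      (s \ (G.neighborSet x ∪ G.neighborSet y)).ncard = s.ncard := by
  rw [← Set.ncard_inter_add_ncard_sdiff_eq_ncard s (G.neighborSet x ∪ G.neighborSet y)
    s.toFinite, Set.inter_union_distrib_left,
    Set.ncard_union_eq (hdisj.mono Set.inter_subset_right Set.inter_subset_right)]

/-- Let `Γ` be a strongly regular graph with parameters `(28, 9, 0, 4)`,
let `x` and `y` be adjacent vertices, and let `Z` be the set of vertices other than `x`, `y`
adjacent to neither `x` nor `y`. Then `Z` has exactly `10` elements and every `z ∈ Z` has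
exactly one neighbor in `Z`; in particular the induced subgraph on `Z` is a disjoint union
of five edges. -/
theorem srg_28_9_0_4_local_structure {V : Type*} [Fintype V]
    (G : SimpleGraph V) [DecidableRel G.Adj]
    (hsrg : G.IsSRGWith 28 9 0 4)
    (x y : V) (hxy : G.Adj x y)
    (Z : Set V) (hZ : Z = {z | z ≠ x ∧ z ≠ y ∧ ¬ G.Adj x z ∧ ¬ G.Adj y z}) :
    Nat.card Z = 10 ∧ ∀ z ∈ Z, Nat.card {w : V // w ∈ Z ∧ G.Adj z w} = 1 := by
  have hdeg (v : V) : (G.neighborSet v).ncard = 9 := by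
    rw [← Nat.card_coe_set_eq, Nat.card_eq_fintype_card, card_neighborSet_eq_degree]
    exact hsrg.regular v
  have hdisj : Disjoint (G.neighborSet x) (G.neighborSet y) := by
    have h := hsrg.of_adj x y hxy
    rwa [← Nat.card_eq_fintype_card, Nat.card_coe_set_eq, Set.ncard_eq_zero,
      commonNeighbors, ← Set.disjoint_iff_inter_eq_empty] at h
  have hcommon {v w : V} (hne : v ≠ w) (hadj : ¬ G.Adj v w) :
      (G.neighborSet v ∩ G.neighborSet w).ncard = 4 := by
    have h := hsrg.of_not_adj hne hadj
    rwa [← Nat.card_eq_fintype_card, Nat.card_coe_set_eq, commonNeighbors] at h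
  have hZ' : Z = Set.univ \ (G.neighborSet x ∪ G.neighborSet y) := by
    ext z
    have := hxy.symm
    simp only [hZ, Set.mem_ofPred_eq, Set.mem_sdiff, Set.mem_univ, true_and, Set.mem_union,
      mem_neighborSet]
    grind
  refine ⟨?_, fun z hz => ?_⟩
  · have h := ncard_inter_neighborSet_add_ncard_sdiff G hdisj Set.univ
    rw [Set.univ_inter, Set.univ_inter, hdeg, hdeg, ← hZ', Set.ncard_univ,
      Nat.card_eq_fintype_card, hsrg.card] at h
    rw [Nat.card_coe_set_eq]
    lia
  · have h := ncard_inter_neighborSet_add_ncard_sdiff G hdisj (G.neighborSet z)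
    have hset : {w | w ∈ Z ∧ G.Adj z w} =
        G.neighborSet z \ (G.neighborSet x ∪ G.neighborSet y) := by
      ext w
      simp [hZ', and_comm]
    have hz' := hz
    rw [hZ] at hz'
    obtain ⟨hzx, hzy, hxz, hyz⟩ := hz'
    rw [hcommon hzx (fun h => hxz h.symm), hcommon hzy (fun h => hyz h.symm), hdeg,
      ← hset, ← Nat.card_coe_set_eq] at h
    change Nat.card {w | w ∈ Z ∧ G.Adj z w} = 1
    lia
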